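/- arXiv:2307.01449 — 2 statements merged into one kernel-verified Lean document; each statement's English description precedes it below -/
import Mathlib

section
/- If internal validity (Y(t) ⊥ T | X, S=1), external validity (Y(t) ⊥ S | X), conditional ignorability (Y(t) ⊥ T | X, S=0), and consistency (Y = Y(T)) all hold, then E[Y | X, T=t, S=0] = E[Y | X, T=t, S=1] almost surely, and hence θ(t) := E_X[E[Y | X, T=t, S=0] − E[Y | X, T=t, S=1]] = 0. -/
open MeasureTheory ProbabilityTheory

/-- `m ∘ X` is a version of the conditional mean `E[Z ∣ X]` on the event `A`:
for every bounded measurable test function `g`,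
`∫_A g(X) Z dP = ∫_A g(X) m(X) dP`. -/
def IsCondMeanOn {Ω : Type*} [MeasurableSpace Ω] (P : Measure Ω) (X : Ω → ℝ)
    (A : Set Ω) (Z : Ω → ℝ) (m : ℝ → ℝ) : Prop :=
  Measurable m ∧ ∀ g : ℝ → ℝ, Measurable g → (∀ x, |g x| ≤ 1) →
    ∫ ω in A, g (X ω) * Z ω ∂P = ∫ ω in A, g (X ω) * m (X ω) ∂P


lemma setIntegral_of_indep {Ω : Type*} [MeasurableSpace Ω] (κ : Measure Ω)
    [IsProbabilityMeasure κ] (f : Ω → ℝ) (hf : AEMeasurable f κ) (E : Set Ω)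
    (h : ∀ q : ℚ, κ (f ⁻¹' Set.Iic (q : ℝ) ∩ E) = κ (f ⁻¹' Set.Iic (q : ℝ)) * κ E) :
    ∫ ω in E, f ω ∂κ = (κ E).toReal * ∫ ω, f ω ∂κ := by
  have hmap : (κ.restrict E).map f = κ E • κ.map f := by
    refine ext_of_generate_finite (⋃ a : ℚ, {Set.Iic (a : ℝ)})
      ?_ Real.isPiSystem_Iic_rat ?_ ?_
    · rw [← Real.borel_eq_generateFrom_Iic_rat]
      exact BorelSpace.measurable_eq
    · intro s hs
      obtain ⟨q, hq⟩ := Set.mem_iUnion.1 hs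
      rw [Set.mem_singleton_iff] at hq
      subst hq
      rw [Measure.map_apply_of_aemeasurable hf.restrict measurableSet_Iic,
        Measure.restrict_apply₀ (hf.restrict.nullMeasurable measurableSet_Iic), h q,
        Measure.smul_apply, Measure.map_apply_of_aemeasurable hf measurableSet_Iic, smul_eq_mul,
        mul_comm]
    · rw [Measure.map_apply_of_aemeasurable hf.restrict MeasurableSet.univ, Measure.smul_apply,
        Measure.map_apply_of_aemeasurable hf MeasurableSet.univ]
      simp
  have h1 := integral_map (μ := κ.restrict E) hf.restrict (f := fun x : ℝ => x)
    aestronglyMeasurable_id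
  have h2 := integral_map (μ := κ) hf (f := fun x : ℝ => x) aestronglyMeasurable_id
  rw [hmap, integral_smul_measure, h2] at h1
  simpa using h1.symm

lemma condExp_indicator_of_condIndep {Ω : Type*} {m : MeasurableSpace Ω}
    [mΩ : MeasurableSpace Ω] [StandardBorelSpace Ω]
    [Nonempty Ω] (hm : m ≤ mΩ) (Q : Measure Ω) [IsFiniteMeasure Q]
    (f g : Ω → ℝ) (hf : Integrable f Q) (c : ℝ) (hE : NullMeasurableSet {ω | g ω = c} Q)
    (hind : CondIndepFun m hm f g Q) :
    Q[{ω | g ω = c}.indicator f | m] =ᵐ[Q] Q[{ω | g ω = c}.indicator (Q[f | m]) | m] := by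
  set E := {ω | g ω = c} with hEdef
  have hone : Integrable (E.indicator (fun _ => (1 : ℝ))) Q :=
    (integrable_const (1 : ℝ)).indicator₀ hE
  have e1 := condExp_ae_eq_integral_condExpKernel (μ := Q) hm (hf.indicator₀ hE)
  have e2 := condExp_ae_eq_integral_condExpKernel (μ := Q) hm hf
  have e3 := condExp_ae_eq_integral_condExpKernel (μ := Q) hm hone
  have hprod : E.indicator (Q[f | m]) = E.indicator (fun _ => (1 : ℝ)) * Q[f | m] := by
    ext ω
    by_cases h : ω ∈ E <;> simp [h]
  have e4 : Q[E.indicator (Q[f | m]) | m] =ᵐ[Q]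
      Q[E.indicator (fun _ => (1 : ℝ)) | m] * Q[f | m] := by
    rw [hprod]
    refine condExp_mul_of_stronglyMeasurable_right stronglyMeasurable_condExp ?_ hone
    rw [← hprod]
    exact integrable_condExp.indicator₀ hE
  have hfk := hf.condExpKernel_ae (m := m)
  have hEk : ∀ᵐ ω ∂Q, NullMeasurableSet E (condExpKernel Q m ω) := by
    obtain ⟨E', -, hE'm, hE'⟩ := hE.exists_measurable_superset_ae_eq
    rw [← condExpKernel_comp_trim (μ := Q) hm] at hE'
    filter_upwards [ae_of_ae_trim hm (Measure.ae_ae_of_ae_comp hE')] with ω hω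
    exact hE'm.nullMeasurableSet.congr hω
  have hq : ∀ᵐ ω ∂Q, ∀ q : ℚ, condExpKernel Q m ω (f ⁻¹' Set.Iic (q : ℝ) ∩ E)
      = condExpKernel Q m ω (f ⁻¹' Set.Iic (q : ℝ)) * condExpKernel Q m ω E := by
    rw [ae_all_iff]
    intro q
    exact ae_of_ae_trim hm (Kernel.IndepFun.meas_inter hind ⟨_, measurableSet_Iic, rfl⟩
      ⟨{c}, measurableSet_singleton c, rfl⟩)
  filter_upwards [e1, e2, e3, e4, hfk, hEk, hq] with ω h1 h2 h3 h4 h5 h6 h7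
  rw [h1, h4, Pi.mul_apply, h2, h3, integral_indicator₀ h6, integral_indicator₀ h6,
    setIntegral_of_indep _ f h5.aemeasurable E h7]
  simp [Measure.real]

lemma bdd_int {Ω : Type*} [MeasurableSpace Ω] (P : Measure Ω) [IsProbabilityMeasure P]
    (X : Ω → ℝ) (hX : Measurable X) (p g : ℝ → ℝ) (hp : Measurable p) (hg : Measurable g)
    (hg1 : ∀ x, |g x| ≤ 1) :
    Integrable (fun ω => g (X ω) * (1 + |p (X ω)|)⁻¹ * p (X ω)) P := by
  refine Integrable.of_bound (C := 1) ?_ (Filter.Eventually.of_forall fun ω => ?_)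
  · apply Measurable.aestronglyMeasurable
    have := hp.comp hX
    have := hg.comp hX
    fun_prop
  · rw [Real.norm_eq_abs, abs_mul, abs_mul, abs_inv, abs_of_pos (by positivity : 0 < 1 + |p (X ω)|),
      mul_assoc]
    have h1 : (1 + |p (X ω)|)⁻¹ * |p (X ω)| ≤ 1 := by
      rw [inv_mul_le_iff₀ (by positivity)]
      linarith
    exact mul_le_one₀ (hg1 _) (by positivity) h1

lemma wt_le (a b : ℝ) (ha : |a| ≤ 1) : |a * (1 + |b|)⁻¹| ≤ 1 := by
  rw [abs_mul, abs_inv, abs_of_pos (by positivity : 0 < 1 + |b|)]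
  refine mul_le_one₀ ha (by positivity) (inv_le_one_of_one_le₀ ?_)
  linarith [abs_nonneg b]

lemma cell_aemeasurable {Ω : Type*} [MeasurableSpace Ω] (P : Measure Ω) [IsProbabilityMeasure P]
    (X : Ω → ℝ) (hX : Measurable X) (f : Ω → ℝ) (p : ℝ → ℝ)
    (hf : IsCondMeanOn P X Set.univ f p) (hpos : ∀ᵐ ω ∂P, 0 < p (X ω)) :
    AEMeasurable f P := by
  obtain ⟨hp, hf⟩ := hf
  have hg : Measurable fun x => 1 * (1 + |p x|)⁻¹ := by fun_prop
  have h := hf _ hg (fun x => wt_le 1 (p x) (by simp))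
  simp only [Measure.restrict_univ] at h
  have hi := bdd_int P X hX p (fun _ => 1) hp measurable_const (by simp)
  have hne : ∫ ω, (1 * (1 + |p (X ω)|)⁻¹ * p (X ω)) ∂P ≠ 0 := by
    intro h0
    rw [integral_eq_zero_iff_of_nonneg_ae ?_ hi] at h0
    · have : ∀ᵐ ω ∂P, False := by
        filter_upwards [h0, hpos] with ω h1 h2
        have : 0 < 1 * (1 + |p (X ω)|)⁻¹ * p (X ω) := by positivity
        exact this.ne' h1
      exact this.exists.choose_spec
    · filter_upwards [hpos] with ω h2
      show (0 : ℝ) ≤ _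
      positivity
  have hI : Integrable (fun ω => 1 * (1 + |p (X ω)|)⁻¹ * f ω) P := by
    by_contra hc
    exact hne (h ▸ integral_undef hc)
  have : f = fun ω => (1 + |p (X ω)|) * (1 * (1 + |p (X ω)|)⁻¹ * f ω) := by
    ext ω
    have : 1 + |p (X ω)| ≠ 0 := by positivity
    field_simp
  rw [this]
  have := hp.comp hX
  exact AEMeasurable.mul (Measurable.aemeasurable (by fun_prop)) hI.aemeasurable

lemma condExp_cell_ne {Ω : Type*} [mΩ : MeasurableSpace Ω] (P : Measure Ω)
    [IsProbabilityMeasure P]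
    (X : Ω → ℝ) (hX : Measurable X) (C : Set Ω) (p : ℝ → ℝ) (hC : NullMeasurableSet C P)
    (hf : IsCondMeanOn P X Set.univ (C.indicator fun _ => (1 : ℝ)) p)
    (hpos : ∀ᵐ ω ∂P, 0 < p (X ω)) :
    ∀ᵐ ω ∂P, (P[C.indicator (fun _ => (1 : ℝ)) | MeasurableSpace.comap X inferInstance]) ω ≠ 0 := by
  obtain ⟨hp, hf⟩ := hf
  have hone : Integrable (C.indicator (fun _ => (1 : ℝ))) P :=
    (integrable_const (1 : ℝ)).indicator₀ hC
  set q := P[C.indicator (fun _ => (1 : ℝ)) | MeasurableSpace.comap X inferInstance] with hq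
  have hqm : StronglyMeasurable[MeasurableSpace.comap X inferInstance] q :=
    stronglyMeasurable_condExp
  obtain ⟨D, hD, hDq⟩ : MeasurableSet[MeasurableSpace.comap X inferInstance] (q ⁻¹' {0}) :=
    hqm.measurable (measurableSet_singleton 0)
  have hD' : MeasurableSet (X ⁻¹' D) := hX hD
  have hz : ∫ ω in X ⁻¹' D, C.indicator (fun _ => (1 : ℝ)) ω ∂P = 0 := by
    rw [← setIntegral_condExp hX.comap_le hone ⟨D, hD, rfl⟩]
    refine setIntegral_eq_zero_of_forall_eq_zero fun ω hω => ?_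
    rw [hDq] at hω
    exact hω
  rw [setIntegral_eq_zero_iff_of_nonneg_ae
    (Filter.Eventually.of_forall fun ω => Set.indicator_nonneg (by simp) ω) hone.integrableOn,
    Filter.EventuallyEq, ae_restrict_iff' hD'] at hz
  have hg1 : ∀ x, |D.indicator (fun _ => (1 : ℝ)) x| ≤ 1 := fun x => by
    by_cases h : x ∈ D <;> simp [h]
  have hgm : Measurable (D.indicator (fun _ => (1 : ℝ))) := measurable_const.indicator hD
  have h := hf (fun x => D.indicator (fun _ => (1 : ℝ)) x * (1 + |p x|)⁻¹) (by fun_prop)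
    (fun x => wt_le _ _ (hg1 x))
  simp only [Measure.restrict_univ] at h
  rw [integral_eq_zero_of_ae] at h
  swap
  · filter_upwards [hz] with ω hω
    by_cases hd : X ω ∈ D
    · simp [hω hd]
    · simp [hd]
  have h' := (integral_eq_zero_iff_of_nonneg_ae ?_ (bdd_int P X hX p _ hp hgm hg1)).1 h.symm
  · filter_upwards [h', hpos] with ω h1 h2 h3
    have hd : ω ∈ X ⁻¹' D := by rw [hDq]; exact h3
    have hd' : X ω ∈ D := hd
    simp only [Set.indicator_of_mem hd', Pi.zero_apply] at h1
    have : 0 < 1 * (1 + |p (X ω)|)⁻¹ * p (X ω) := by positivity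
    exact this.ne' h1
  · filter_upwards [hpos] with ω h2
    have : 0 ≤ D.indicator (fun _ => (1 : ℝ)) (X ω) := Set.indicator_nonneg (by simp) _
    show (0 : ℝ) ≤ _
    positivity

lemma key {Ω : Type*} {m : MeasurableSpace Ω} [mΩ : MeasurableSpace Ω] [StandardBorelSpace Ω] [Nonempty Ω]
    (P : Measure Ω) [IsProbabilityMeasure P]
    (Y Z T S X : Ω → ℝ) (t s : ℝ) (hX : Measurable X)
    (hmX : m = MeasurableSpace.comap X inferInstance) (hm : m ≤ mΩ)
    (hYZ : ∀ ω, T ω = t → Y ω = Z ω) (hZ : Integrable Z P)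
    (hSm : NullMeasurableSet {ω | S ω = s} P) (hTm : NullMeasurableSet {ω | T ω = t} P)
    (p : ℝ → ℝ)
    (hp : IsCondMeanOn P X Set.univ (({ω | T ω = t} ∩ {ω | S ω = s}).indicator fun _ => (1 : ℝ)) p)
    (hpos : ∀ᵐ ω ∂P, 0 < p (X ω)) [IsFiniteMeasure (P[|{ω | S ω = s}])]
    (h1 : CondIndepFun m hm Z T
      (P[|{ω | S ω = s}]))
    (h2 : CondIndepFun m hm Z S P)
    (μ : ℝ → ℝ)
    (hμ : IsCondMeanOn P X ({ω | T ω = t} ∩ {ω | S ω = s}) Y μ)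
    (hμI : Integrable (fun ω => μ (X ω)) P) :
    ∀ᵐ ω ∂P, μ (X ω) = (P[Z | m]) ω := by
  set E := {ω | S ω = s} with hE
  set F := {ω | T ω = t} with hF
  set h := P[Z | m] with hh
  have hhI : Integrable h P := integrable_condExp
  have hFE : NullMeasurableSet (F ∩ E) P := hTm.inter hSm
  have hnn := condExp_cell_ne P X hX (F ∩ E) p hFE hp hpos
  rw [← hmX] at hnn
  have hEne : P E ≠ 0 := by
    intro h0
    have hz : (F ∩ E).indicator (fun _ => (1 : ℝ)) =ᵐ[P] 0 := by
      have : ∀ᵐ ω ∂P, ω ∉ E := measure_eq_zero_iff_ae_notMem.1 h0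
      filter_upwards [this] with ω hω
      simp [hω]
    have h3 := condExp_congr_ae (m := m) hz
    have : ∀ᵐ ω ∂P, False := by
      filter_upwards [hnn, h3] with ω h4 h5
      rw [condExp_zero] at h5
      exact h4 h5
    exact this.exists.choose_spec
  set Q := P[|E] with hQ
  have hac : Q ≪ P := cond_absolutelyContinuous
  have hcQ : ∀ f : Ω → ℝ, Integrable f P → Integrable f Q := fun f hf =>
    hf.integrableOn.smul_measure (by simpa using hEne)
  have hci : ∀ (f : Ω → ℝ) (B : Set Ω), MeasurableSet B →
      ∫ ω in B, f ω ∂Q = ((P E)⁻¹).toReal * ∫ ω in B, E.indicator f ω ∂P := by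
    intro f B hB
    rw [hQ, ProbabilityTheory.cond, Measure.restrict_smul, integral_smul_measure,
      Measure.restrict_restrict hB, integral_indicator₀ (hSm.mono_ac Measure.restrict_le_self.absolutelyContinuous),
      Measure.restrict_restrict₀
        (hSm.mono_ac Measure.restrict_le_self.absolutelyContinuous), Set.inter_comm, smul_eq_mul]
  have hc0 : ((P E)⁻¹).toReal ≠ 0 := by
    rw [ENNReal.toReal_ne_zero]
    exact ⟨by simp, by simpa using hEne⟩
  have hTQ : NullMeasurableSet F Q := hTm.mono_ac hac
  -- conditional expectation under Q agrees with that under P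
  have k2 := condExp_indicator_of_condIndep hm P Z S hZ s hSm h2
  have hhQ : h =ᵐ[Q] Q[Z | m] := by
    refine ae_eq_condExp_of_forall_setIntegral_eq hm (hcQ _ hZ)
      (fun _ _ _ => (hcQ _ hhI).integrableOn) ?_
      stronglyMeasurable_condExp.aestronglyMeasurable
    intro B hB _
    rw [hci _ _ (hm _ hB), hci _ _ (hm _ hB),
      ← setIntegral_condExp hm (hZ.indicator₀ hSm) hB,
      ← setIntegral_condExp hm (hhI.indicator₀ hSm) hB]
    congr 1
    refine setIntegral_congr_ae (hm _ hB) ?_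
    filter_upwards [k2] with ω hω _
    exact hω.symm
  have k1 := condExp_indicator_of_condIndep hm Q Z T (hcQ _ hZ) t hTQ h1
  have k3 : ∀ B, MeasurableSet[m] B →
      ∫ ω in B, (F ∩ E).indicator Z ω ∂P = ∫ ω in B, (F ∩ E).indicator h ω ∂P := by
    intro B hB
    have : ∫ ω in B, F.indicator Z ω ∂Q = ∫ ω in B, F.indicator h ω ∂Q := by
      rw [← setIntegral_condExp hm ((hcQ _ hZ).indicator₀ hTQ) hB]
      rw [setIntegral_congr_ae (g := Q[F.indicator (Q[Z | m]) | m]) (hm _ hB)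
        (by filter_upwards [k1] with ω hω _ using hω)]
      rw [setIntegral_condExp hm (integrable_condExp.indicator₀ hTQ) hB]
      refine setIntegral_congr_ae (hm _ hB) ?_
      filter_upwards [hhQ] with ω hω _
      by_cases hf : ω ∈ F <;> simp [hf, hω]
    rw [hci _ _ (hm _ hB), hci _ _ (hm _ hB)] at this
    have := mul_left_cancel₀ hc0 this
    simpa only [Set.indicator_indicator, Set.inter_comm E F] using this
  have hμm : StronglyMeasurable[m] (fun ω => μ (X ω)) :=
    (hμ.1.comp (hmX ▸ comap_measurable X)).stronglyMeasurable
  have k4 : ∀ B, MeasurableSet[m] B →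
      ∫ ω in B, (F ∩ E).indicator Z ω ∂P
        = ∫ ω in B, (F ∩ E).indicator (fun ω => μ (X ω)) ω ∂P := by
    intro B hB
    rw [hmX] at hB
    obtain ⟨D, hD, rfl⟩ := hB
    have hD' := hX hD
    have hg1 : ∀ x, |D.indicator (fun _ => (1 : ℝ)) x| ≤ 1 := fun x => by
      by_cases h : x ∈ D <;> simp [h]
    have := hμ.2 _ (measurable_const.indicator hD) hg1
    rw [← integral_indicator₀ hFE, ← integral_indicator₀ hFE] at this
    rw [← integral_indicator hD', ← integral_indicator hD']
    convert this using 2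
    · ext ω
      by_cases ha : ω ∈ F ∩ E
      · have hy : Y ω = Z ω := hYZ ω ha.1
        by_cases hb : X ω ∈ D <;> simp [Set.indicator, ha.1, ha.2, hb, hy]
      · by_cases hb : X ω ∈ D <;> simp only [Set.indicator, ha, if_false, ite_self]
    · ext ω
      by_cases ha : ω ∈ F ∩ E
      · by_cases hb : X ω ∈ D <;> simp [Set.indicator, ha.1, ha.2, hb]
      · by_cases hb : X ω ∈ D <;> simp only [Set.indicator, ha, if_false, ite_self]
  set W : Ω → ℝ := fun ω => μ (X ω) - h ω with hW
  have hWI : Integrable W P := hμI.sub hhI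
  have hWm : StronglyMeasurable[m] W := hμm.sub stronglyMeasurable_condExp
  have hone : Integrable ((F ∩ E).indicator (fun _ => (1 : ℝ))) P :=
    (integrable_const (1 : ℝ)).indicator₀ hFE
  have hprod : (F ∩ E).indicator W = (F ∩ E).indicator (fun _ => (1 : ℝ)) * W := by
    ext ω
    by_cases h : ω ∈ F ∩ E <;> simp only [Set.indicator, h, Pi.mul_apply, if_true, if_false,
      one_mul, zero_mul]
  have hz : (0 : Ω → ℝ) =ᵐ[P] P[(F ∩ E).indicator W | m] := by
    refine ae_eq_condExp_of_forall_setIntegral_eq hm (hWI.indicator₀ hFE)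
      (fun _ _ _ => (integrable_zero _ _ _).integrableOn) ?_
      aestronglyMeasurable_const
    intro B hB _
    have hsub : (F ∩ E).indicator W
        = fun ω => (F ∩ E).indicator (fun ω => μ (X ω)) ω - (F ∩ E).indicator h ω := by
      ext ω
      by_cases h : ω ∈ F ∩ E <;> simp only [Set.indicator, h, if_true, if_false, sub_zero, hW]
    rw [hsub, integral_sub (hμI.indicator₀ hFE).integrableOn (hhI.indicator₀ hFE).integrableOn,
      ← k3 B hB, ← k4 B hB]
    simp
  have hpull := condExp_mul_of_stronglyMeasurable_right (μ := P) hWm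
    (hprod ▸ hWI.indicator₀ hFE) hone
  rw [← hprod] at hpull
  filter_upwards [hz, hpull, hnn] with ω a b c
  rw [← a] at b
  have : W ω = 0 := by
    have b' : (0 : ℝ) = _ * W ω := b
    rcases mul_eq_zero.1 b'.symm with d | d
    · exact absurd d c
    · exact d
  exact sub_eq_zero.1 this

/-- under internal validity, external validity, conditional ignorability and
consistency, `E[Y ∣ X, T=t, S=0] = E[Y ∣ X, T=t, S=1]` a.s., hence
`θ(t) = E_X[E[Y ∣ X,T=t,S=0] − E[Y ∣ X,T=t,S=1]] = 0`. -/
theorem theta_zero_under_all_assumptions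
    {Ω : Type*} [MeasurableSpace Ω] [StandardBorelSpace Ω] [Nonempty Ω]
    (P : Measure Ω) [IsProbabilityMeasure P]
    (Y0 Y1 Y T S X : Ω → ℝ) (t : ℝ) (ht : t = 0 ∨ t = 1)
    (hX : Measurable X) (hT : ∀ ω, T ω = 0 ∨ T ω = 1) (hS : ∀ ω, S ω = 0 ∨ S ω = 1)
    -- consistency
    (hcons : ∀ ω, Y ω = if T ω = 1 then Y1 ω else Y0 ω)
    (hYInt : Integrable Y P) (hY0Int : Integrable Y0 P) (hY1Int : Integrable Y1 P)
    -- overlap: all conditional cells have positive probability given X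
    (pcell : ℝ → ℝ → ℝ → ℝ)
    (hpcell : ∀ t' ∈ ({0, 1} : Set ℝ), ∀ s' ∈ ({0, 1} : Set ℝ),
      IsCondMeanOn P X Set.univ
        (fun ω => if T ω = t' ∧ S ω = s' then 1 else 0) (pcell t' s'))
    (hpos : ∀ᵐ ω ∂P, ∀ t' ∈ ({0, 1} : Set ℝ), ∀ s' ∈ ({0, 1} : Set ℝ),
      0 < pcell t' s' (X ω))
    [IsFiniteMeasure (P[|{ω | S ω = 1}])] [IsFiniteMeasure (P[|{ω | S ω = 0}])]
    -- A2 internal validity: (Y(0),Y(1)) ⊥ T ∣ X on S = 1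
    (hA2 : CondIndepFun (MeasurableSpace.comap X inferInstance) hX.comap_le
      (fun ω => (Y0 ω, Y1 ω)) T (P[|{ω | S ω = 1}]))
    -- A3 external validity: (Y(0),Y(1)) ⊥ S ∣ X
    (hA3 : CondIndepFun (MeasurableSpace.comap X inferInstance) hX.comap_le
      (fun ω => (Y0 ω, Y1 ω)) S P)
    -- A4 conditional ignorability: (Y(0),Y(1)) ⊥ T ∣ X on S = 0
    (hA4 : CondIndepFun (MeasurableSpace.comap X inferInstance) hX.comap_le
      (fun ω => (Y0 ω, Y1 ω)) T (P[|{ω | S ω = 0}]))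
    -- μ0 = E[Y ∣ X, T=t, S=0], μ1 = E[Y ∣ X, T=t, S=1]
    (μ0 μ1 : ℝ → ℝ)
    (hμ0 : IsCondMeanOn P X ({ω | T ω = t} ∩ {ω | S ω = 0}) Y μ0)
    (hμ1 : IsCondMeanOn P X ({ω | T ω = t} ∩ {ω | S ω = 1}) Y μ1)
    (hμ0Int : Integrable (fun ω => μ0 (X ω)) P)
    (hμ1Int : Integrable (fun ω => μ1 (X ω)) P) :
    (∀ᵐ ω ∂P, μ0 (X ω) = μ1 (X ω)) ∧
      ∫ ω, (μ0 (X ω) - μ1 (X ω)) ∂P = 0 := by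
  classical
  have hts : ∀ t' ∈ ({0, 1} : Set ℝ), ∀ s' ∈ ({0, 1} : Set ℝ),
      (fun ω => if T ω = t' ∧ S ω = s' then (1 : ℝ) else 0)
        = ({ω | T ω = t'} ∩ {ω | S ω = s'}).indicator fun _ => (1 : ℝ) := by
    intro t' _ s' _
    ext ω
    simp [Set.indicator]
  have hpos' : ∀ t' ∈ ({0, 1} : Set ℝ), ∀ s' ∈ ({0, 1} : Set ℝ), ∀ᵐ ω ∂P,
      0 < pcell t' s' (X ω) := by
    intro t' a s' b
    filter_upwards [hpos] with ω h using h t' a s' b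
  have hcell : ∀ t' ∈ ({0, 1} : Set ℝ), ∀ s' ∈ ({0, 1} : Set ℝ),
      NullMeasurableSet ({ω | T ω = t'} ∩ {ω | S ω = s'}) P := by
    intro t' a s' b
    have h := cell_aemeasurable P X hX _ _ (hpcell t' a s' b) (hpos' t' a s' b)
    have h' := h.nullMeasurable (measurableSet_singleton (1 : ℝ))
    convert h' using 1
    ext ω
    by_cases hc : T ω = t' ∧ S ω = s' <;> simp [hc]
  have m0 : (0 : ℝ) ∈ ({0, 1} : Set ℝ) := by simp
  have m1 : (1 : ℝ) ∈ ({0, 1} : Set ℝ) := by simp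
  have hSm : ∀ s' ∈ ({0, 1} : Set ℝ), NullMeasurableSet {ω | S ω = s'} P := by
    intro s' b
    convert (hcell 0 m0 s' b).union (hcell 1 m1 s' b) using 1
    ext ω
    rcases hT ω with h | h <;> simp [h]
  have hTm : ∀ t' ∈ ({0, 1} : Set ℝ), NullMeasurableSet {ω | T ω = t'} P := by
    intro t' b
    convert (hcell t' b 0 m0).union (hcell t' b 1 m1) using 1
    ext ω
    rcases hS ω with h | h <;> simp [h]
  have main : ∀ (Z : Ω → ℝ), Integrable Z P → (∀ ω, T ω = t → Y ω = Z ω) →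
      (∃ φ : ℝ × ℝ → ℝ, Measurable φ ∧ Z = φ ∘ fun ω => (Y0 ω, Y1 ω)) →
      ∀ᵐ ω ∂P, μ0 (X ω) = μ1 (X ω) := by
    rintro Z hZ hYZ ⟨φ, hφ, hZφ⟩
    have mt : t ∈ ({0, 1} : Set ℝ) := ht
    have i2 := hA2.comp hφ measurable_id
    have i3 := hA3.comp hφ measurable_id
    have i4 := hA4.comp hφ measurable_id
    rw [← hZφ, Function.id_comp] at i2 i3 i4
    have r0 := key P Y Z T S X t 0 hX rfl hX.comap_le hYZ hZ (hSm 0 m0) (hTm t mt) (pcell t 0)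
      (hts t mt 0 m0 ▸ hpcell t mt 0 m0) (hpos' t mt 0 m0) i4 i3 μ0 hμ0 hμ0Int
    have r1 := key P Y Z T S X t 1 hX rfl hX.comap_le hYZ hZ (hSm 1 m1) (hTm t mt) (pcell t 1)
      (hts t mt 1 m1 ▸ hpcell t mt 1 m1) (hpos' t mt 1 m1) i2 i3 μ1 hμ1 hμ1Int
    filter_upwards [r0, r1] with ω a b
    rw [a, b]
  have hae : ∀ᵐ ω ∂P, μ0 (X ω) = μ1 (X ω) := by
    rcases ht with h | h
    · refine main Y0 hY0Int (fun ω hω => ?_) ⟨Prod.fst, measurable_fst, rfl⟩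
      rw [hcons, hω, h]
      simp
    · refine main Y1 hY1Int (fun ω hω => ?_) ⟨Prod.snd, measurable_snd, rfl⟩
      rw [hcons, hω, h]
      simp
  refine ⟨hae, integral_eq_zero_of_ae ?_⟩
  filter_upwards [hae] with ω h
  simp [h]
end

section
/- Let μ₀(X) = E[Y | X, T=1, S=0], β₀(X) = P(T=1 | X, S=1), γ₀(X) = P(S=1 | X), and define Λ = μ₀(X) + [ST/(γ₀(X)β₀(X))](Y − μ₀(X)). If internal validity ((Y(0),Y(1)) ⊥ T | X, S=1), external validity ((Y(0),Y(1)) ⊥ S | X), conditional ignorability ((Y(0),Y(1)) ⊥ T | X, S=0), and consistency (Y = Y(T)) hold, then E[Λ] = E[Y(1)]. -/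
open MeasureTheory ProbabilityTheory

lemma dr_aux_condExp_mul {Ω : Type*} (m : MeasurableSpace Ω) [mΩ : MeasurableSpace Ω] [StandardBorelSpace Ω] [Nonempty Ω]
    (Q : Measure Ω) [IsFiniteMeasure Q] (hm : m ≤ mΩ) (V W : Ω → ℝ)
    (hV : Integrable V Q) (hW : Integrable W Q) (hVW : Integrable (fun ω => V ω * W ω) Q)
    (hCI : CondIndepFun m hm V W Q) :
    Q[fun ω => V ω * W ω | m] =ᵐ[Q] fun ω => (Q[V | m]) ω * (Q[W | m]) ω := by
  have hVae : ∀ᵐ a ∂(Q.trim hm), V =ᵐ[condExpKernel Q m a] hV.1.mk V := by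
    apply Measure.ae_ae_of_ae_comp
    rw [condExpKernel_comp_trim]
    exact hV.1.ae_eq_mk
  have hWae : ∀ᵐ a ∂(Q.trim hm), W =ᵐ[condExpKernel Q m a] hW.1.mk W := by
    apply Measure.ae_ae_of_ae_comp
    rw [condExpKernel_comp_trim]
    exact hW.1.ae_eq_mk
  have hV' : Measurable (hV.1.mk V) := hV.1.stronglyMeasurable_mk.measurable
  have hW' : Measurable (hW.1.mk W) := hW.1.stronglyMeasurable_mk.measurable
  have hCI' : CondIndepFun m hm (hV.1.mk V) (hW.1.mk W) Q :=
    Kernel.IndepFun.congr' hCI hVae hWae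
  rw [condIndepFun_iff_map_prod_eq_prod_map_map hV' hW'] at hCI'
  filter_upwards [ae_of_ae_trim hm hCI', ae_of_ae_trim hm hVae, ae_of_ae_trim hm hWae,
    condExp_ae_eq_integral_condExpKernel hm hV, condExp_ae_eq_integral_condExpKernel hm hW,
    condExp_ae_eq_integral_condExpKernel hm hVW] with a h1 h2 h3 h4 h5 h6
  rw [h4, h5, h6]
  have hind : IndepFun (hV.1.mk V) (hW.1.mk W) (condExpKernel Q m a) := by
    rw [indepFun_iff_map_prod_eq_prod_map_map hV'.aemeasurable hW'.aemeasurable]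
    rw [Kernel.prod_apply, Kernel.map_apply _ hV', Kernel.map_apply _ hW',
      Kernel.map_apply _ (hV'.prodMk hW')] at h1
    exact h1
  have hind2 : IndepFun V W (condExpKernel Q m a) := hind.congr h2.symm h3.symm
  exact hind2.integral_fun_mul_eq_mul_integral
    ⟨_, hV.1.stronglyMeasurable_mk, h2⟩ ⟨_, hW.1.stronglyMeasurable_mk, h3⟩

lemma dr_aux_key {Ω : Type*} (m : MeasurableSpace Ω) [mΩ : MeasurableSpace Ω] [StandardBorelSpace Ω] [Nonempty Ω]
    (Q : Measure Ω) [IsFiniteMeasure Q] (X V W : Ω → ℝ) (hX : Measurable X)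
    (hmdef : m = MeasurableSpace.comap X inferInstance) (hm : m ≤ mΩ)
    (hV : Integrable V Q) (hW : AEStronglyMeasurable W Q) (hW1 : ∀ ω, |W ω| ≤ 1)
    (hCI : CondIndepFun m hm V W Q)
    (b h : ℝ → ℝ) (hb : Measurable b) (hh : Measurable h)
    (hbB : ∀ᵐ ω ∂Q, |b (X ω)| ≤ 1) (C : ℝ) (hhB : ∀ᵐ ω ∂Q, |h (X ω)| ≤ C)
    (hE : ∀ g : ℝ → ℝ, Measurable g → (∀ x, |g x| ≤ 1) →
      ∫ ω, g (X ω) * W ω ∂Q = ∫ ω, g (X ω) * b (X ω) ∂Q) :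
    ∫ ω, h (X ω) * (V ω * W ω) ∂Q = ∫ ω, h (X ω) * b (X ω) * V ω ∂Q := by
  have hXm : Measurable[m] X := by
    rw [hmdef]
    exact comap_measurable X
  have hWint : Integrable W Q := Integrable.of_bound hW 1 (Filter.Eventually.of_forall hW1)
  have hbX : Integrable (fun ω => b (X ω)) Q :=
    Integrable.of_bound (hb.comp hX).aestronglyMeasurable 1 hbB
  have hVW : Integrable (fun ω => V ω * W ω) Q :=
    hV.mul_bdd hW (Filter.Eventually.of_forall hW1)
  have hbW : (fun ω => b (X ω)) =ᵐ[Q] Q[W | m] := by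
    apply ae_eq_condExp_of_forall_setIntegral_eq hm hWint
    · intro s _ _
      exact hbX.integrableOn
    · intro s hs _
      rw [hmdef] at hs
      obtain ⟨B, hB, rfl⟩ := hs
      have := hE (B.indicator 1) (measurable_one.indicator hB) (by
        intro x
        by_cases hx : x ∈ B <;> simp [hx])
      rw [← integral_indicator (hX hB), ← integral_indicator (hX hB)]
      have e : ∀ f : Ω → ℝ, (X ⁻¹' B).indicator f = fun ω => B.indicator 1 (X ω) * f ω := by
        intro f
        ext ω
        by_cases hx : X ω ∈ B <;> simp [hx]
      rw [e, e]
      exact this.symm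
    · exact (hb.comp hXm).stronglyMeasurable.aestronglyMeasurable
  have hmul := dr_aux_condExp_mul m Q hm V W hV hWint hVW hCI
  have hhm : StronglyMeasurable[m] (fun ω => h (X ω)) := (hh.comp hXm).stronglyMeasurable
  have hhbm : StronglyMeasurable[m] (fun ω => h (X ω) * b (X ω)) :=
    ((hh.comp hXm).mul (hb.comp hXm)).stronglyMeasurable
  have i1 : Integrable ((fun ω => h (X ω)) * (fun ω => V ω * W ω)) Q :=
    hVW.bdd_mul (hh.comp hX).aestronglyMeasurable hhB
  have i2 : Integrable ((fun ω => h (X ω) * b (X ω)) * V) Q := by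
    refine hV.bdd_mul (c := C) ((hh.comp hX).mul (hb.comp hX)).aestronglyMeasurable ?_
    filter_upwards [hhB, hbB] with ω h1 h2
    rw [Real.norm_eq_abs, abs_mul]
    nlinarith [abs_nonneg (h (X ω)), abs_nonneg (b (X ω))]
  have c1 := condExp_mul_of_stronglyMeasurable_left hhm i1 hVW
  have c2 := condExp_mul_of_stronglyMeasurable_left hhbm i2 hV
  calc ∫ ω, h (X ω) * (V ω * W ω) ∂Q
      = ∫ ω, (Q[(fun ω => h (X ω)) * (fun ω => V ω * W ω) | m]) ω ∂Q :=
        (integral_condExp hm).symm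
    _ = ∫ ω, (Q[(fun ω => h (X ω) * b (X ω)) * V | m]) ω ∂Q := by
        apply integral_congr_ae
        filter_upwards [c1, c2, hmul, hbW] with ω h1 h2 h3 h4
        rw [h1, h2]
        simp only [Pi.mul_apply]
        rw [h3, ← h4]
        ring
    _ = ∫ ω, h (X ω) * b (X ω) * V ω ∂Q := integral_condExp hm

/-- under internal validity, external validity, conditional ignorability and
consistency, the doubly robust score `Λ` satisfies `E[Λ] = E[Y(1)]`. -/
theorem dr_score_unbiased_for_pate
    {Ω : Type*} [MeasurableSpace Ω] [StandardBorelSpace Ω] [Nonempty Ω]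
    (P : Measure Ω) [IsProbabilityMeasure P]
    (Y0 Y1 Y T S X : Ω → ℝ)
    (hX : Measurable X) (hT : ∀ ω, T ω = 0 ∨ T ω = 1) (hS : ∀ ω, S ω = 0 ∨ S ω = 1)
    -- consistency
    (hcons : ∀ ω, Y ω = if T ω = 1 then Y1 ω else Y0 ω)
    (hY0Int : Integrable Y0 P) (hY1Int : Integrable Y1 P)
    -- nuisance functions: μ0 = E[Y ∣ X, T=1, S=0], β0 = P(T=1 ∣ X, S=1), γ0 = P(S=1 ∣ X)
    (μ0 β0 γ0 : ℝ → ℝ)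
    (hμ0 : IsCondMeanOn P X ({ω | T ω = 1} ∩ {ω | S ω = 0}) Y μ0)
    (hβ0 : IsCondMeanOn P X {ω | S ω = 1} (fun ω => if T ω = 1 then 1 else 0) β0)
    (hγ0 : IsCondMeanOn P X Set.univ (fun ω => if S ω = 1 then 1 else 0) γ0)
    -- overlap
    (ε : ℝ) (hε : 0 < ε)
    (hbdd : ∀ᵐ ω ∂P, ε ≤ β0 (X ω) ∧ β0 (X ω) ≤ 1 - ε ∧ ε ≤ γ0 (X ω) ∧ γ0 (X ω) ≤ 1 - ε)
    [IsFiniteMeasure (P[|{ω | S ω = 1}])] [IsFiniteMeasure (P[|{ω | S ω = 0}])]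
    -- A2 internal validity
    (hA2 : CondIndepFun (MeasurableSpace.comap X inferInstance) hX.comap_le
      (fun ω => (Y0 ω, Y1 ω)) T (P[|{ω | S ω = 1}]))
    -- A3 external validity
    (hA3 : CondIndepFun (MeasurableSpace.comap X inferInstance) hX.comap_le
      (fun ω => (Y0 ω, Y1 ω)) S P)
    -- A4 conditional ignorability
    (hA4 : CondIndepFun (MeasurableSpace.comap X inferInstance) hX.comap_le
      (fun ω => (Y0 ω, Y1 ω)) T (P[|{ω | S ω = 0}]))
    -- the score Λ
    (Λ : Ω → ℝ)
    (hΛ : ∀ ω, Λ ω = μ0 (X ω)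
      + (S ω * T ω) / (γ0 (X ω) * β0 (X ω)) * (Y ω - μ0 (X ω)))
    (hΛInt : Integrable Λ P) :
    ∫ ω, Λ ω ∂P = ∫ ω, Y1 ω ∂P := by
  classical
  obtain ⟨hβm, hβ⟩ := hβ0
  obtain ⟨hγm, hγ⟩ := hγ0
  have hμm := hμ0.1
  have hSif : ∀ ω, (if S ω = 1 then (1:ℝ) else 0) = S ω := by
    intro ω
    rcases hS ω with h | h <;> simp [h]
  have hTif : ∀ ω, (if T ω = 1 then (1:ℝ) else 0) = T ω := by
    intro ω
    rcases hT ω with h | h <;> simp [h]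
  simp only [hSif, Measure.restrict_univ] at hγ
  simp only [hTif] at hβ
  have hS1 : ∀ ω, |S ω| ≤ 1 := by
    intro ω
    rcases hS ω with h | h <;> simp [h]
  have hT1 : ∀ ω, |T ω| ≤ 1 := by
    intro ω
    rcases hT ω with h | h <;> simp [h]
  have hγB : ∀ᵐ ω ∂P, |γ0 (X ω)| ≤ 1 := by
    filter_upwards [hbdd] with ω h
    rw [abs_le]
    constructor <;> linarith [h.2.2.1, h.2.2.2]
  have hβB : ∀ᵐ ω ∂P, |β0 (X ω)| ≤ 1 := by
    filter_upwards [hbdd] with ω h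
    rw [abs_le]
    constructor <;> linarith [h.1, h.2.1]
  have hγint : Integrable (fun ω => γ0 (X ω)) P :=
    Integrable.of_bound (hγm.comp hX).aestronglyMeasurable 1 hγB
  have hβint : Integrable (fun ω => β0 (X ω)) P :=
    Integrable.of_bound (hβm.comp hX).aestronglyMeasurable 1 hβB
  -- S is a.e. measurable, since its integral is nonzero
  have hSpos : ε ≤ ∫ ω, S ω ∂P := by
    have h1 := hγ (fun _ => 1) measurable_const (by simp)
    simp only [one_mul] at h1
    rw [h1]
    have : ∫ _ω, ε ∂P ≤ ∫ ω, γ0 (X ω) ∂P := by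
      apply integral_mono_ae (integrable_const _) hγint
      filter_upwards [hbdd] with ω h using h.2.2.1
    simpa using this
  have hSint : Integrable S P := by
    by_contra hc
    rw [integral_undef hc] at hSpos
    linarith
  set A : Set Ω := {ω | S ω = 1} with hA
  have hAm : NullMeasurableSet A P :=
    hSint.1.aemeasurable.nullMeasurable (measurableSet_singleton (1:ℝ))
  have hAint : ∀ f : Ω → ℝ, ∫ ω in A, f ω ∂P = ∫ ω, S ω * f ω ∂P := by
    intro f
    rw [← integral_indicator₀ hAm]
    congr 1
    ext ω
    rcases hS ω with h | h <;> simp [hA, h]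
  have hPA : 0 < P.real A := by
    have h1 := hAint (fun _ => 1)
    simp only [mul_one, integral_const, smul_eq_mul, measureReal_restrict_apply_univ] at h1
    linarith
  have hPA0 : P A ≠ 0 := by
    intro h
    simp [Measure.real, h] at hPA
  -- T is a.e. measurable on A
  have hTint : Integrable T (P.restrict A) := by
    by_contra hc
    have h1 := hβ (fun _ => 1) measurable_const (by simp)
    simp only [one_mul] at h1
    rw [integral_undef hc] at h1
    have : ∫ _ω in A, ε ∂P ≤ ∫ ω in A, β0 (X ω) ∂P := by
      apply integral_mono_ae (integrable_const _) hβint.integrableOn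
      filter_upwards [ae_restrict_of_ae hbdd] with ω h using h.1
    rw [← h1] at this
    simp only [integral_const, smul_eq_mul, measureReal_restrict_apply_univ] at this
    nlinarith
  have hQint : ∀ f : Ω → ℝ, ∫ ω, f ω ∂(P[|A]) = (P.real A)⁻¹ * ∫ ω in A, f ω ∂P := by
    intro f
    rw [ProbabilityTheory.cond, integral_smul_measure, ENNReal.toReal_inv]
    rfl
  have hQac : P[|A] ≪ P := cond_absolutelyContinuous
  -- the inverse propensity weighting identity
  have step : ∀ (V : Ω → ℝ) (g : ℝ → ℝ) (C : ℝ), Integrable V P → Measurable g →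
      (∀ x, |g x| ≤ C) →
      CondIndepFun (MeasurableSpace.comap X inferInstance) hX.comap_le V T (P[|A]) →
      CondIndepFun (MeasurableSpace.comap X inferInstance) hX.comap_le V S P →
      Integrable (fun ω => g (X ω) * ((S ω * T ω) / (γ0 (X ω) * β0 (X ω)) * V ω)) P ∧
      ∫ ω, g (X ω) * ((S ω * T ω) / (γ0 (X ω) * β0 (X ω)) * V ω) ∂P
        = ∫ ω, g (X ω) * V ω ∂P := by
    intro V g C hV hg hgC h2 h3
    set h : ℝ → ℝ := fun x => g x / (γ0 x * β0 x) with hh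
    have hhm : Measurable h := hg.div (hγm.mul hβm)
    have hhB : ∀ᵐ ω ∂P, |h (X ω)| ≤ C / (ε * ε) := by
      filter_upwards [hbdd] with ω hω
      have hpos : ε * ε ≤ γ0 (X ω) * β0 (X ω) :=
        mul_le_mul hω.2.2.1 hω.1 hε.le (by linarith [hω.2.2.1])
      have hεε : 0 < ε * ε := by positivity
      rw [hh, abs_div, abs_of_pos (lt_of_lt_of_le hεε hpos)]
      have : 0 ≤ C := (abs_nonneg _).trans (hgC (X ω))
      gcongr
      exact hgC _
    have hhβB : ∀ᵐ ω ∂P, |h (X ω) * β0 (X ω)| ≤ C / (ε * ε) := by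
      filter_upwards [hhB, hβB] with ω k1 k2
      rw [abs_mul]
      nlinarith [abs_nonneg (h (X ω)), abs_nonneg (β0 (X ω))]
    have hVA : Integrable V (P.restrict A) := hV.integrableOn
    have e1 := dr_aux_key _ (P[|A]) X V T hX rfl hX.comap_le (hVA.smul_measure (by simp [hPA0]))
      (hTint.1.smul_measure _) hT1 h2 β0 h hβm hhm (hQac.ae_le hβB) _ (hQac.ae_le hhB) (by
        intro g hg hg1
        rw [hQint, hQint, hβ g hg hg1])
    rw [hQint, hQint] at e1
    have e1' := mul_left_cancel₀ (inv_ne_zero hPA.ne') e1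
    rw [hAint, hAint] at e1'
    have e2 := dr_aux_key _ P X V S hX rfl hX.comap_le hV hSint.1 hS1 h3 γ0 (fun x => h x * β0 x) hγm
      (hhm.mul hβm) hγB _ hhβB hγ
    have heq : (fun ω => g (X ω) * ((S ω * T ω) / (γ0 (X ω) * β0 (X ω)) * V ω))
        = fun ω => S ω * (h (X ω) * (V ω * T ω)) := by
      ext ω
      simp only [hh]
      ring
    constructor
    · rw [heq]
      have : Integrable (fun ω => h (X ω) * (V ω * T ω)) (P.restrict A) := by
        refine Integrable.bdd_mul (c := C / (ε * ε)) ?_ (hhm.comp hX).aestronglyMeasurable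
          (ae_restrict_of_ae hhB)
        exact hVA.mul_bdd hTint.1 (Filter.Eventually.of_forall hT1)
      have := IntegrableOn.integrable_indicator₀ this hAm
      refine this.congr (Filter.Eventually.of_forall ?_)
      intro ω
      rcases hS ω with h | h <;> simp [hA, h]
    · rw [heq, e1']
      trans ∫ ω, h (X ω) * β0 (X ω) * (V ω * S ω) ∂P
      · congr 1
        ext ω
        ring
      · rw [e2]
        apply integral_congr_ae
        filter_upwards [hbdd] with ω hω
        have k1 : γ0 (X ω) ≠ 0 := by linarith [hω.2.2.1]
        have k2 : β0 (X ω) ≠ 0 := by linarith [hω.1]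
        simp only [hh]
        field_simp
  have hY1T : CondIndepFun (MeasurableSpace.comap X inferInstance) hX.comap_le Y1 T (P[|A]) :=
    hA2.comp measurable_snd measurable_id
  have hY1S : CondIndepFun (MeasurableSpace.comap X inferInstance) hX.comap_le Y1 S P :=
    hA3.comp measurable_snd measurable_id
  -- truncation
  let B : ℕ → Set ℝ := fun n => {x | |μ0 x| ≤ n}
  have hB : ∀ n, MeasurableSet (B n) := fun n => measurableSet_le hμm.abs measurable_const
  let g : ℕ → ℝ → ℝ := fun n => (B n).indicator 1
  have hg : ∀ n, Measurable (g n) := fun n => measurable_one.indicator (hB n)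
  have hg1 : ∀ n x, |g n x| ≤ 1 := by
    intro n x
    by_cases hx : x ∈ B n <;> simp [g, hx]
  have hgμ : ∀ n x, |g n x * μ0 x| ≤ n := by
    intro n x
    by_cases hx : x ∈ B n
    · have hx' : |μ0 x| ≤ n := hx
      simpa [g, hx] using hx'
    · simp [g, hx]
  have hglim : ∀ x, Filter.Tendsto (fun n => g n x) Filter.atTop (nhds 1) := by
    intro x
    apply tendsto_const_nhds.congr'
    obtain ⟨N, hN⟩ := exists_nat_ge |μ0 x|
    filter_upwards [Filter.eventually_ge_atTop N] with n hn
    have : x ∈ B n := hN.trans (by exact_mod_cast hn)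
    simp [g, this]
  have htrunc : ∀ n, ∫ ω, g n (X ω) * Λ ω ∂P = ∫ ω, g n (X ω) * Y1 ω ∂P := by
    intro n
    obtain ⟨i1, s1⟩ := step Y1 (g n) 1 hY1Int (hg n) (hg1 n) hY1T hY1S
    obtain ⟨i2, s2⟩ := step (fun _ => 1) (fun x => g n x * μ0 x) n (integrable_const _)
      ((hg n).mul hμm) (hgμ n) (condIndepFun_const_left _ _) (condIndepFun_const_left _ _)
    have i3 : Integrable (fun ω => g n (X ω) * μ0 (X ω) * 1) P := by
      refine Integrable.of_bound (C := n) ?_ (Filter.Eventually.of_forall ?_)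
      · exact ((((hg n).mul hμm).comp hX).mul_const 1).aestronglyMeasurable
      · intro ω
        simpa using hgμ n (X ω)
    have heq : (fun ω => g n (X ω) * Λ ω) = fun ω => (g n (X ω) * μ0 (X ω) * 1
        + g n (X ω) * ((S ω * T ω) / (γ0 (X ω) * β0 (X ω)) * Y1 ω))
        - g n (X ω) * μ0 (X ω) * ((S ω * T ω) / (γ0 (X ω) * β0 (X ω)) * 1) := by
      ext ω
      rw [hΛ, hcons]
      rcases hT ω with h | h
      · simp [h]
      · simp only [h, if_true]
        ring
    have i4 : Integrable (fun ω => g n (X ω) * μ0 (X ω) * 1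
        + g n (X ω) * ((S ω * T ω) / (γ0 (X ω) * β0 (X ω)) * Y1 ω)) P := i3.add i1
    rw [heq, integral_sub i4 i2, integral_add i3 i1, s1, s2]
    ring
  have hlim : ∀ F : Ω → ℝ, Integrable F P →
      Filter.Tendsto (fun n => ∫ ω, g n (X ω) * F ω ∂P) Filter.atTop (nhds (∫ ω, F ω ∂P)) := by
    intro F hF
    apply tendsto_integral_of_dominated_convergence (fun ω => |F ω|)
    · intro n
      exact ((hg n).comp hX).aestronglyMeasurable.mul hF.1
    · exact hF.abs
    · intro n
      refine Filter.Eventually.of_forall fun ω => ?_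
      rw [Real.norm_eq_abs, abs_mul]
      exact mul_le_of_le_one_left (abs_nonneg _) (hg1 n _)
    · refine Filter.Eventually.of_forall fun ω => ?_
      simpa using (hglim (X ω)).mul_const (F ω)
  have l1 := hlim Λ hΛInt
  simp only [htrunc] at l1
  exact tendsto_nhds_unique l1 (hlim Y1 hY1Int)
end
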